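/- arXiv:2405.13540 — 2 statements merged into one kernel-verified Lean document; each statement's English description precedes it below -/
import Mathlib

section
/- Fix x₀ ∈ ℝ and a sequence β : ℕ → ℝ with β s ∈ [0,1] for all s. Define probability measures μ_t on ℝ recursively by μ₀ = δ_{x₀} (the Dirac measure at x₀) and μ_t = pushforward of the product measure μ_{t−1} ⊗ N(0,1) under the map (x, z) ↦ √(1−β_t)·x + √β_t·z. Then for every t ≥ 1, μ_t = N(√ᾱ_t·x₀, 1−ᾱ_t), where ᾱ_t = ∏_{s=1}^{t} (1−β_s). -/
open MeasureTheory ProbabilityTheory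

open scoped NNReal

/-- The law of `a * x + b * z` for independent real Gaussians `x` and `z`. -/
theorem map_mul_add_mul_gaussianReal_prod (a b m₁ m₂ : ℝ) (v₁ v₂ : ℝ≥0) :
    Measure.map (fun p : ℝ × ℝ => a * p.1 + b * p.2)
        ((gaussianReal m₁ v₁).prod (gaussianReal m₂ v₂)) =
      gaussianReal (a * m₁ + b * m₂)
        (.mk (a ^ 2) (sq_nonneg _) * v₁ + .mk (b ^ 2) (sq_nonneg _) * v₂) := by
  rw [← gaussianReal_conv_gaussianReal, ← gaussianReal_map_const_mul,
    ← gaussianReal_map_const_mul, Measure.conv,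
    Measure.map_prod_map _ _ (by fun_prop) (by fun_prop),
    Measure.map_map (by fun_prop) (by fun_prop)]
  rfl

/-- The closed form of the DDPM forward diffusion kernel in one dimension: if
`μ 0 = δ_{x₀}` and `μ t` is the law of `√(1-β t)·x + √(β t)·z` with `x ~ μ (t-1)` and
`z ~ N(0,1)` independent, then `μ t = N(√ᾱ_t·x₀, 1-ᾱ_t)` with `ᾱ_t = ∏_{s=1}^t (1-β s)`. -/
theorem stmt_1 (x₀ : ℝ) (β : ℕ → ℝ) (hβ : ∀ s, β s ∈ Set.Icc (0 : ℝ) 1)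
    (μ : ℕ → Measure ℝ)
    (h0 : μ 0 = Measure.dirac x₀)
    (hrec : ∀ t : ℕ, 1 ≤ t →
      μ t = Measure.map (fun p : ℝ × ℝ => Real.sqrt (1 - β t) * p.1 + Real.sqrt (β t) * p.2)
        ((μ (t - 1)).prod (gaussianReal 0 1))) :
    ∀ t : ℕ, 1 ≤ t →
      μ t = gaussianReal (Real.sqrt (∏ s ∈ Finset.Icc 1 t, (1 - β s)) * x₀)
        ((1 - ∏ s ∈ Finset.Icc 1 t, (1 - β s)).toNNReal) := by
  suffices h : ∀ t : ℕ, μ t = gaussianReal (Real.sqrt (∏ s ∈ Finset.Icc 1 t, (1 - β s)) * x₀)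
      ((1 - ∏ s ∈ Finset.Icc 1 t, (1 - β s)).toNNReal) from fun t _ => h t
  intro t
  induction t with
  | zero => simp [h0]
  | succ t ih =>
    rw [hrec (t + 1) (by omega), Nat.add_sub_cancel, ih, map_mul_add_mul_gaussianReal_prod,
      Finset.prod_Icc_succ_top (by omega)]
    have hnonneg : ∀ s, 0 ≤ 1 - β s := fun s => sub_nonneg.2 (hβ s).2
    have hle : ∀ s, 1 - β s ≤ 1 := fun s => sub_le_self _ (hβ s).1
    have hP0 : 0 ≤ ∏ s ∈ Finset.Icc 1 t, (1 - β s) := Finset.prod_nonneg fun s _ => hnonneg s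
    have hP1 : ∏ s ∈ Finset.Icc 1 t, (1 - β s) ≤ 1 :=
      Finset.prod_le_one (fun s _ => hnonneg s) fun s _ => hle s
    congr 1
    · rw [Real.sqrt_mul hP0]
      ring
    · apply NNReal.eq
      have hPβ := mul_le_one₀ hP1 (hnonneg (t + 1)) (hle (t + 1))
      simp only [NNReal.coe_add, NNReal.coe_mul, NNReal.coe_mk, NNReal.coe_one,
        Real.sq_sqrt (hnonneg (t + 1)), Real.sq_sqrt (hβ (t + 1)).1,
        Real.coe_toNNReal _ (sub_nonneg.2 hP1), Real.coe_toNNReal _ (sub_nonneg.2 hPβ)]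
      ring
end

section
/- Let γ be a probability measure on ℝ^D, let f, f_n : ℝ^D → ℝ^D be Borel-measurable maps with f_n(x) → f(x) for every x. Suppose that for each n the pushforward ν_n = γ ∘ f_n⁻¹ has a density p_n with respect to Lebesgue measure, that the pushforward ν = γ ∘ f⁻¹ has a continuous density p with respect to Lebesgue measure, and that there exist constants L and M such that every p_n is L-Lipschitz and bounded by M. Then sup_{x ∈ ℝ^D} |p_n(x) − p(x)| → 0 as n → ∞. -/
open MeasureTheory

/-- The tent function of height and radius `r` centred at `x`. -/
noncomputable def tent {E : Type*} [PseudoMetricSpace E] (r : ℝ) (x y : E) : ℝ :=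
  max 0 (r - dist y x)

section Tent

variable {E : Type*} [PseudoMetricSpace E]

lemma tent_nonneg (r : ℝ) (x y : E) : 0 ≤ tent r x y := le_max_left _ _

lemma tent_le {r : ℝ} (hr : 0 ≤ r) (x y : E) : tent r x y ≤ r :=
  max_le hr (sub_le_self _ dist_nonneg)

lemma tent_eq_zero {r : ℝ} {x y : E} (h : r ≤ dist y x) : tent r x y = 0 :=
  max_eq_left (by linarith)

lemma continuous_tent (r : ℝ) (x : E) : Continuous (tent r x) := by
  unfold tent; fun_prop

lemma abs_tent_sub_tent_le_dist (r : ℝ) (x y z : E) :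
    |tent r x y - tent r x z| ≤ dist y z := by
  unfold tent
  refine (abs_max_sub_max_le_max _ _ _ _).trans (max_le (by simp) ?_)
  rw [sub_sub_sub_cancel_left, abs_sub_comm]
  exact abs_dist_sub_le y z x

lemma abs_tent_sub_tent_le {r : ℝ} (hr : 0 ≤ r) (x y z : E) :
    |tent r x y - tent r x z| ≤ min r (dist y z) :=
  le_min (abs_sub_le_of_nonneg_of_le (tent_nonneg r x y) (tent_le hr x y)
    (tent_nonneg r x z) (tent_le hr x z)) (abs_tent_sub_tent_le_dist r x y z)

lemma hasCompactSupport_tent [ProperSpace E] (r : ℝ) (x : E) : HasCompactSupport (tent r x) :=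
  HasCompactSupport.intro (isCompact_closedBall x r) fun y hy =>
    tent_eq_zero (by rw [Metric.mem_closedBall, not_le] at hy; exact hy.le)

end Tent

section Pushforward

variable {Ω E : Type*} [MeasurableSpace Ω] [NormedAddCommGroup E]
  [MeasurableSpace E] [BorelSpace E] [SecondCountableTopology E]

lemma integrable_min_dist {γ : Measure Ω} [IsFiniteMeasure γ] {g h : Ω → E}
    (hg : Measurable g) (hh : Measurable h) {r : ℝ} (hr : 0 ≤ r) :
    Integrable (fun ω => min r (dist (g ω) (h ω))) γ := by
  refine Integrable.of_bound (C := r)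
    (measurable_const.min (hg.dist hh)).aestronglyMeasurable (ae_of_all _ fun ω => ?_)
  rw [Real.norm_of_nonneg (le_min hr dist_nonneg)]
  exact min_le_left _ _

lemma tendsto_integral_min_dist {γ : Measure Ω} [IsFiniteMeasure γ] {f : Ω → E}
    {fn : ℕ → Ω → E} (hf : Measurable f) (hfn : ∀ n, Measurable (fn n))
    (hconv : ∀ ω, Filter.Tendsto (fun n => fn n ω) Filter.atTop (nhds (f ω)))
    {r : ℝ} (hr : 0 ≤ r) :
    Filter.Tendsto (fun n => ∫ ω, min r (dist (fn n ω) (f ω)) ∂γ) Filter.atTop (nhds 0) := by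
  have key := tendsto_integral_of_dominated_convergence (μ := γ)
    (F := fun n ω => min r (dist (fn n ω) (f ω))) (f := fun _ => (0 : ℝ)) (fun _ => r)
    (fun n => (integrable_min_dist (hfn n) hf hr).aestronglyMeasurable) (integrable_const r)
    (fun n => ae_of_all _ fun ω => by
      rw [Real.norm_of_nonneg (le_min hr dist_nonneg)]
      exact min_le_left _ _)
    (ae_of_all _ fun ω => by
      have h := (tendsto_const_nhds (x := r)).min (tendsto_iff_dist_tendsto_zero.1 (hconv ω))
      rwa [min_eq_right hr] at h)
  simpa using key

lemma abs_integral_tent_map_sub_le {γ : Measure Ω} [IsFiniteMeasure γ] {g h : Ω → E}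
    (hg : Measurable g) (hh : Measurable h) {r : ℝ} (hr : 0 ≤ r) (x : E) :
    |∫ y, tent r x y ∂(γ.map g) - ∫ y, tent r x y ∂(γ.map h)|
      ≤ ∫ ω, min r (dist (g ω) (h ω)) ∂γ := by
  have hc := continuous_tent r x
  have hint : ∀ {k : Ω → E}, Measurable k → Integrable (fun ω => tent r x (k ω)) γ :=
    fun hk => Integrable.of_bound (C := r) (hc.measurable.comp hk).aestronglyMeasurable
      (ae_of_all _ fun ω => by
        rw [Real.norm_of_nonneg (tent_nonneg _ _ _)]; exact tent_le hr _ _)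
  rw [integral_map hg.aemeasurable hc.aestronglyMeasurable,
    integral_map hh.aemeasurable hc.aestronglyMeasurable, ← integral_sub (hint hg) (hint hh)]
  exact (abs_integral_le_integral_abs).trans
    (integral_mono ((hint hg).sub (hint hh)).abs (integrable_min_dist hg hh hr)
      fun ω => abs_tent_sub_tent_le hr _ _ _)

end Pushforward

lemma integral_tent_eq {E : Type*} [NormedAddCommGroup E] [MeasurableSpace E] [BorelSpace E]
    (μ : Measure E) [μ.IsAddRightInvariant] (r : ℝ) (x : E) :
    ∫ y, tent r x y ∂μ = ∫ y, tent r 0 y ∂μ := by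
  rw [← integral_add_right_eq_self _ x]
  simp [tent, dist_eq_norm]

section Density

variable {E : Type*} [NormedAddCommGroup E] [NormedSpace ℝ E] [FiniteDimensional ℝ E]
  [MeasurableSpace E] [BorelSpace E] (μ : Measure E) [μ.IsAddHaarMeasure]

lemma integral_tent_pos {r : ℝ} (hr : 0 < r) : 0 < ∫ y, tent r (0 : E) y ∂μ := by
  have := FiniteDimensional.proper_real E
  exact (continuous_tent r 0).integral_pos_of_hasCompactSupport_nonneg_nonzero
    (hasCompactSupport_tent r 0) (tent_nonneg r 0) (x := 0) (by simp [tent, hr])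

lemma abs_integral_tent_withDensity_sub_le {q : E → ℝ} (hq : Continuous q)
    (hq0 : ∀ y, 0 ≤ q y) {r δ : ℝ} {x : E} (hδ : ∀ y, dist y x < r → |q y - q x| ≤ δ) :
    |∫ y, tent r x y ∂(μ.withDensity fun y => ENNReal.ofReal (q y)) - (∫ y, tent r 0 y ∂μ) * q x|
      ≤ (∫ y, tent r 0 y ∂μ) * δ := by
  have := FiniteDimensional.proper_real E
  have hc := continuous_tent r x
  have hs := hasCompactSupport_tent r x
  have hi : Integrable (tent r x) μ := hc.integrable_of_hasCompactSupport hs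
  have hiq : Integrable (fun y => tent r x y * q y) μ :=
    (hc.mul hq).integrable_of_hasCompactSupport hs.mul_right
  have hdens : ∫ y, tent r x y ∂(μ.withDensity fun y => ENNReal.ofReal (q y))
      = ∫ y, tent r x y * q y ∂μ := by
    rw [integral_withDensity_eq_integral_toReal_smul hq.measurable.ennreal_ofReal
      (ae_of_all _ fun _ => ENNReal.ofReal_lt_top)]
    simp only [ENNReal.toReal_ofReal (hq0 _), smul_eq_mul, mul_comm]
  rw [hdens, ← integral_tent_eq μ r x, ← integral_mul_const, ← integral_mul_const,
    ← integral_sub hiq (hi.mul_const _)]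
  refine abs_integral_le_integral_abs.trans
    (integral_mono (hiq.sub (hi.mul_const _)).abs (hi.mul_const _) fun y => ?_)
  simp only [← mul_sub, abs_mul, abs_of_nonneg (tent_nonneg r x y)]
  rcases lt_or_ge (dist y x) r with h | h
  · exact mul_le_mul_of_nonneg_left (hδ y h) (tent_nonneg _ _ _)
  · simp [tent_eq_zero h]

/-- Densities of pushforwards along a pointwise convergent sequence converge uniformly on any
set where the limit density has a uniform modulus of continuity, if they are equi-Lipschitz. -/
lemma tendstoUniformlyOn_density {Ω : Type*} [MeasurableSpace Ω] {γ : Measure Ω}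
    [IsFiniteMeasure γ] {f : Ω → E} {fn : ℕ → Ω → E}
    (hf : Measurable f) (hfn : ∀ n, Measurable (fn n))
    (hconv : ∀ ω, Filter.Tendsto (fun n => fn n ω) Filter.atTop (nhds (f ω)))
    {p : E → ℝ} {pn : ℕ → E → ℝ} (hp : Continuous p) (hp0 : ∀ x, 0 ≤ p x)
    (hpn0 : ∀ n x, 0 ≤ pn n x)
    (hp_dens : γ.map f = μ.withDensity fun x => ENNReal.ofReal (p x))
    (hpn_dens : ∀ n, γ.map (fn n) = μ.withDensity fun x => ENNReal.ofReal (pn n x))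
    {L : NNReal} (hpn : ∀ n, LipschitzWith L (pn n)) {S : Set E}
    (hS : ∀ ε > 0, ∃ r > 0, ∀ x ∈ S, ∀ y, dist y x < r → |p y - p x| ≤ ε) :
    TendstoUniformlyOn pn p Filter.atTop S := by
  have := FiniteDimensional.proper_real E
  rw [Metric.tendstoUniformlyOn_iff]
  intro ε hε
  obtain ⟨r₀, hr₀, hosc⟩ := hS (ε / 4) (by positivity)
  have hL : (0 : ℝ) < L + 1 := by positivity
  set r : ℝ := min r₀ (ε / 4 / (L + 1))
  have hr : 0 < r := by positivity
  have hLr : L * r ≤ ε / 4 := by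
    have h : r * (L + 1) ≤ ε / 4 := (le_div_iff₀ hL).1 (min_le_right _ _)
    nlinarith
  set c := ∫ y, tent r (0 : E) y ∂μ
  have hc : 0 < c := integral_tent_pos μ hr
  filter_upwards [(tendsto_integral_min_dist (γ := γ) hf hfn hconv hr.le).eventually_lt_const
    (show 0 < c * (ε / 4) by positivity)] with n hn x hx
  have h₁ := abs_integral_tent_withDensity_sub_le μ (r := r) hp hp0
    fun y hy => hosc x hx y (hy.trans_le (min_le_left _ _))
  have h₂ := abs_integral_tent_withDensity_sub_le μ (r := r) (x := x) (δ := ε / 4)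
    (hpn n).continuous (hpn0 n) fun y hy => by
      have h := (hpn n).dist_le_mul y x
      rw [Real.dist_eq] at h
      exact h.trans ((mul_le_mul_of_nonneg_left hy.le L.coe_nonneg).trans hLr)
  have h₃ := abs_integral_tent_map_sub_le (γ := γ) (hfn n) hf hr.le x
  rw [hp_dens, hpn_dens n] at h₃
  rw [abs_le] at h₁ h₂ h₃
  rw [Real.dist_eq, abs_lt]
  constructor <;> refine lt_of_mul_lt_mul_left ?_ hc.le <;> nlinarith [mul_pos hc hε]

end Density

/-- Converse-Scheffé statement (Theorem 3.3 of the paper): if `fn → f` pointwise, the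
pushforwards `γ ∘ fn⁻¹` have densities `pn` that are uniformly Lipschitz and uniformly
bounded, and `γ ∘ f⁻¹` has a continuous density `p`, then `pn → p` uniformly on `ℝ^D`. -/
theorem stmt_14 (D : ℕ) (γ : Measure (EuclideanSpace ℝ (Fin D))) [IsProbabilityMeasure γ]
    (f : EuclideanSpace ℝ (Fin D) → EuclideanSpace ℝ (Fin D))
    (fn : ℕ → EuclideanSpace ℝ (Fin D) → EuclideanSpace ℝ (Fin D))
    (hf : Measurable f) (hfn : ∀ n, Measurable (fn n))
    (hconv : ∀ x, Filter.Tendsto (fun n => fn n x) Filter.atTop (nhds (f x)))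
    (p : EuclideanSpace ℝ (Fin D) → ℝ) (pn : ℕ → EuclideanSpace ℝ (Fin D) → ℝ)
    (hp_cont : Continuous p) (hp_nonneg : ∀ x, 0 ≤ p x) (hpn_nonneg : ∀ n x, 0 ≤ pn n x)
    (hp_dens : γ.map f = volume.withDensity (fun x => ENNReal.ofReal (p x)))
    (hpn_dens : ∀ n, γ.map (fn n) = volume.withDensity (fun x => ENNReal.ofReal (pn n x)))
    (L : NNReal) (M : ℝ)
    (hpn_lip : ∀ n, LipschitzWith L (pn n)) (hpn_bdd : ∀ n x, pn n x ≤ M) :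
    TendstoUniformly pn p Filter.atTop := by
  have hpt : ∀ x, Filter.Tendsto (fun n => pn n x) Filter.atTop (nhds (p x)) := fun x =>
    tendstoUniformlyOn_singleton_iff_tendsto.1 <|
      tendstoUniformlyOn_density volume hf hfn hconv hp_cont hp_nonneg hpn_nonneg hp_dens
        hpn_dens hpn_lip fun ε hε => by
          obtain ⟨r, hr, h⟩ := Metric.continuous_iff.1 hp_cont x ε hε
          refine ⟨r, hr, ?_⟩
          rintro _ rfl y hy
          exact (h y hy).le
  have hp_lip : LipschitzWith L p := LipschitzWith.of_dist_le_mul fun x y =>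
    le_of_tendsto' ((hpt x).dist (hpt y)) fun n => (hpn_lip n).dist_le_mul x y
  refine tendstoUniformlyOn_univ.1 <|
    tendstoUniformlyOn_density volume hf hfn hconv hp_cont hp_nonneg hpn_nonneg hp_dens
      hpn_dens hpn_lip fun ε hε => ?_
  obtain ⟨r, hr, h⟩ := Metric.uniformContinuous_iff.1 hp_lip.uniformContinuous ε hε
  exact ⟨r, hr, fun x _ y hy => (h hy).le⟩
end
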